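/- arXiv:1802.03218 — 2 statements merged into one kernel-verified Lean document; each statement's English description precedes it below -/
import Mathlib

section
/- Let Ñ > 2 and a > 0 be real numbers, R₀ > 0, and 1 < p < (Ñ+2)/(Ñ−2). Let U be a C² function on [R₀,∞) with U(r) > 0 and U'(r) < 0 for all r ≥ R₀, U''(R₀) = 0, satisfying the ODE U''(r) + (Ñ−1)·U'(r)/r = −U(r)^p/a for all r ≥ R₀, and suppose that for some constant c₁ > 0 one has r^{Ñ−2}·U(r) → c₁ and r^{Ñ−1}·U'(r) → −(Ñ−2)·c₁ as r → ∞. Set C := U(R₀)^{p−1}/(a·(Ñ−1)·(Ñ−2)) and c := c₁·(c₁^{−Ñ}·U(R₀)²)^{1/(Ñ−2)}. Then for every r ≥ R₀: U(R₀)/(1 + C·(r² − R₀²))^{(Ñ−2)/2} ≤ U(r) ≤ U(R₀)/(1 + c·(r² − R₀²))^{(Ñ−2)/2}. -/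
open Real Filter Set

/-- A function with nonnegative derivative on a closed half-line is monotone there. -/
lemma monotoneOn_Ici_of_hasDerivAt_nonneg {f f' : ℝ → ℝ} {x₀ : ℝ}
    (hf : ∀ r ∈ Ici x₀, HasDerivAt f (f' r) r) (hf' : ∀ r ∈ Ici x₀, 0 ≤ f' r) :
    MonotoneOn f (Ici x₀) := by
  refine monotoneOn_of_hasDerivWithinAt_nonneg (f' := f') (convex_Ici x₀)
    (fun r hr => (hf r hr).continuousAt.continuousWithinAt) ?_ ?_
  · exact fun r hr => (hf r (interior_subset hr)).hasDerivWithinAt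
  · exact fun r hr => hf' r (interior_subset hr)

/-- A function with nonpositive derivative on a closed half-line is antitone there. -/
lemma antitoneOn_Ici_of_hasDerivAt_nonpos {f f' : ℝ → ℝ} {x₀ : ℝ}
    (hf : ∀ r ∈ Ici x₀, HasDerivAt f (f' r) r) (hf' : ∀ r ∈ Ici x₀, f' r ≤ 0) :
    AntitoneOn f (Ici x₀) := by
  refine antitoneOn_of_hasDerivWithinAt_nonpos (f' := f') (convex_Ici x₀)
    (fun r hr => (hf r hr).continuousAt.continuousWithinAt) ?_ ?_
  · exact fun r hr => (hf r (interior_subset hr)).hasDerivWithinAt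
  · exact fun r hr => hf' r (interior_subset hr)

/-- The exponent of a positive fast-decaying solution exceeds the Serrin exponent. -/
lemma serrin_lt_of_fast_decay {m a R0 p c1 : ℝ} {U U' U'' : ℝ → ℝ}
    (ha : 0 < a) (hR0 : 0 < R0) (hp : 0 < p)
    (hU'' : ∀ r ∈ Ici R0, HasDerivAt U' (U'' r) r)
    (hpos : ∀ r ∈ Ici R0, 0 < U r)
    (hode : ∀ r ∈ Ici R0, U'' r + (m - 1) * U' r / r = -(U r ^ p) / a)
    (hc1 : 0 < c1) {l : ℝ}
    (hlim1 : Tendsto (fun r => r ^ (m - 2) * U r) atTop (nhds c1))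
    (hlim2 : Tendsto (fun r => r ^ (m - 1) * U' r) atTop (nhds l)) :
    m < p * (m - 2) := by
  by_contra! hle
  obtain ⟨R1, hR1⟩ := eventually_atTop.1
    ((hlim1.eventually (lt_mem_nhds (half_lt_self hc1))).and
      ((eventually_ge_atTop R0).and (eventually_ge_atTop 1)))
  have hK : 0 < (c1 / 2) ^ p / a := by positivity
  set K := (c1 / 2) ^ p / a with hKdef
  have hanti : AntitoneOn (fun r => r ^ (m - 1) * U' r + K * Real.log r) (Ici R1) := by
    refine antitoneOn_Ici_of_hasDerivAt_nonpos
      (f' := fun r => -(r ^ (m - 1) * U r ^ p) / a + K / r) ?_ ?_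
    · intro r hr
      obtain ⟨-, hr0, hr1⟩ := hR1 r hr
      have hrpos : 0 < r := by linarith
      have hd := ((Real.hasDerivAt_rpow_const (p := m - 1) (Or.inl hrpos.ne')).mul
        (hU'' r hr0)).add ((Real.hasDerivAt_log hrpos.ne').const_mul K)
      refine hd.congr_deriv ?_
      have h1 : r ^ (m - 1 - 1) = r ^ (m - 1) / r := by rw [Real.rpow_sub_one hrpos.ne']
      have h2 : U'' r = -(U r ^ p) / a - (m - 1) * U' r / r := by linarith [hode r hr0]
      rw [h1, h2]
      field_simp
      ring
    · intro r hr
      obtain ⟨hlow, hr0, hr1⟩ := hR1 r hr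
      have hrpos : 0 < r := by linarith
      have hUr := hpos r hr0
      have h1 : (c1 / 2) ^ p ≤ r ^ ((m - 2) * p) * U r ^ p := by
        rw [Real.rpow_mul hrpos.le, ← Real.mul_rpow (by positivity) hUr.le]
        exact Real.rpow_le_rpow (by positivity) hlow.le hp.le
      have h2 : r ^ ((m - 2) * p) ≤ r ^ m :=
        Real.rpow_le_rpow_of_exponent_le hr1 (by linarith)
      have h3 : (c1 / 2) ^ p ≤ r ^ m * U r ^ p :=
        h1.trans (by gcongr)
      have h4 : r ^ (m - 1) = r ^ m / r := Real.rpow_sub_one hrpos.ne' m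
      have h5 : -(r ^ (m - 1) * U r ^ p) / a + K / r
          = ((c1 / 2) ^ p - r ^ m * U r ^ p) / (a * r) := by
        rw [h4, hKdef]
        field_simp
        ring
      rw [h5]
      exact div_nonpos_of_nonpos_of_nonneg (by linarith) (by positivity)
  have htop : Tendsto (fun r => r ^ (m - 1) * U' r + K * Real.log r) atTop atTop :=
    hlim2.add_atTop (Real.tendsto_log_atTop.const_mul_atTop hK)
  obtain ⟨r, hr, hr1⟩ := ((htop.eventually_gt_atTop
    (R1 ^ (m - 1) * U' R1 + K * Real.log R1)).and (eventually_ge_atTop R1)).exists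
  exact absurd (hanti self_mem_Ici hr1 hr1) (not_le.2 hr)

/-- The Pohozaev function of a subcritical fast-decaying solution is nonpositive. -/
lemma pohozaev_nonpos {m a R0 p c1 l : ℝ} {U U' U'' : ℝ → ℝ}
    (hm : 2 < m) (ha : 0 < a) (hR0 : 0 < R0) (hp1 : 1 < p) (hp2 : p * (m - 2) ≤ m + 2)
    (hU' : ∀ r ∈ Ici R0, HasDerivAt U (U' r) r)
    (hU'' : ∀ r ∈ Ici R0, HasDerivAt U' (U'' r) r)
    (hpos : ∀ r ∈ Ici R0, 0 < U r)
    (hode : ∀ r ∈ Ici R0, U'' r + (m - 1) * U' r / r = -(U r ^ p) / a)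
    (hc1 : 0 < c1)
    (hlim1 : Tendsto (fun r => r ^ (m - 2) * U r) atTop (nhds c1))
    (hlim2 : Tendsto (fun r => r ^ (m - 1) * U' r) atTop (nhds l)) :
    ∀ r ∈ Ici R0, r ^ m * (U' r ^ 2 / 2 + U r ^ (p + 1) / (a * (p + 1)))
      + (m - 2) / 2 * (r ^ (m - 1) * (U r * U' r)) ≤ 0 := by
  have hserrin := serrin_lt_of_fast_decay ha hR0 (by linarith) hU'' hpos hode hc1 hlim1 hlim2
  have hmono : MonotoneOn (fun r => r ^ m * (U' r ^ 2 / 2 + U r ^ (p + 1) / (a * (p + 1)))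
      + (m - 2) / 2 * (r ^ (m - 1) * (U r * U' r))) (Ici R0) := by
    refine monotoneOn_Ici_of_hasDerivAt_nonneg
      (f' := fun r => r ^ (m - 1) * (U r * U r ^ p) / a * (m / (p + 1) - (m - 2) / 2)) ?_ ?_
    · intro r hr
      have hrpos : 0 < r := hR0.trans_le hr
      have hUr := hpos r hr
      have hd := ((Real.hasDerivAt_rpow_const (p := m) (Or.inl hrpos.ne')).mul
        ((((hU'' r hr).pow 2).div_const 2).add
          (((hU' r hr).rpow_const (p := p + 1) (Or.inl hUr.ne')).div_const (a * (p + 1))))).add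
        (((Real.hasDerivAt_rpow_const (p := m - 1) (Or.inl hrpos.ne')).mul
          ((hU' r hr).mul (hU'' r hr))).const_mul ((m - 2) / 2))
      refine hd.congr_deriv ?_
      have h0 : r ^ m = r ^ (m - 1) * r := by
        rw [Real.rpow_sub_one hrpos.ne']; field_simp
      have h1 : r ^ (m - 1 - 1) = r ^ (m - 1) / r := by rw [Real.rpow_sub_one hrpos.ne']
      have h2 : U'' r = -(U r ^ p) / a - (m - 1) * U' r / r := by linarith [hode r hr]
      have h3 : U r ^ (p + 1) = U r ^ p * U r := Real.rpow_add_one hUr.ne' p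
      have h4 : p + 1 - 1 = p := by ring
      have h5 : p + 1 ≠ 0 := by linarith
      simp only [Pi.add_apply, Pi.mul_apply, Pi.pow_apply]
      rw [h1, h2, h4, h3, h0]
      field_simp
      ring
    · intro r hr
      have hrpos : 0 < r := hR0.trans_le hr
      have hUr := hpos r hr
      have h1 : 0 ≤ m / (p + 1) - (m - 2) / 2 := by
        rw [sub_nonneg, div_le_div_iff₀ (by norm_num) (by linarith)]
        nlinarith
      positivity
  have hneg : ∀ {e : ℝ}, e < 0 → Tendsto (fun r : ℝ => r ^ e) atTop (nhds 0) := fun {e} he => by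
    simpa using tendsto_rpow_neg_atTop (neg_pos.2 he)
  have hlimU := hlim1.rpow_const (p := p + 1) (Or.inl hc1.ne')
  have hlim : Tendsto (fun r => r ^ m * (U' r ^ 2 / 2 + U r ^ (p + 1) / (a * (p + 1)))
      + (m - 2) / 2 * (r ^ (m - 1) * (U r * U' r))) atTop (nhds 0) := by
    have hsum := ((((hlim2.pow 2).mul (hneg (e := -(m - 2)) (by linarith))).div_const 2).add
      ((hlimU.mul (hneg (e := m - (m - 2) * (p + 1)) (by nlinarith))).div_const
        (a * (p + 1)))).add
      (((hlim2.mul hlim1).mul (hneg (e := -(m - 2)) (by linarith))).const_mul ((m - 2) / 2))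
    simp only [mul_zero, zero_div, add_zero] at hsum
    refine hsum.congr' ?_
    filter_upwards [eventually_ge_atTop R0] with r hr
    have hrpos : 0 < r := hR0.trans_le hr
    have hUr := hpos r hr
    have h1 : r ^ (m - 1) * r ^ (m - 1) * r ^ (-(m - 2)) = r ^ m := by
      rw [← Real.rpow_add hrpos, ← Real.rpow_add hrpos]; congr 1; ring
    have h2 : r ^ (m - 1) * r ^ (m - 2) * r ^ (-(m - 2)) = r ^ (m - 1) := by
      rw [← Real.rpow_add hrpos, ← Real.rpow_add hrpos]; congr 1; ring
    have h3 : (r ^ (m - 2) * U r) ^ (p + 1) * r ^ (m - (m - 2) * (p + 1))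
        = r ^ m * U r ^ (p + 1) := by
      rw [Real.mul_rpow (by positivity) hUr.le, ← Real.rpow_mul hrpos.le, mul_right_comm,
        ← Real.rpow_add hrpos]
      congr 2; ring
    rw [h3]
    linear_combination (U' r ^ 2 / 2) * h1 + (m - 2) / 2 * U r * U' r * h2
  intro r hr
  refine ge_of_tendsto hlim ?_
  filter_upwards [eventually_ge_atTop r] with s hs
  exact hmono hr (le_trans (mem_Ici.1 hr) hs) hs

/-- For a subcritical fast-decaying solution, the slope `-U' U ^ (-m/(m-2)) / r`
is nonincreasing. -/
lemma antitoneOn_slope {m a R0 p c1 l : ℝ} {U U' U'' : ℝ → ℝ}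
    (hm : 2 < m) (ha : 0 < a) (hR0 : 0 < R0) (hp1 : 1 < p) (hp2 : p * (m - 2) ≤ m + 2)
    (hU' : ∀ r ∈ Ici R0, HasDerivAt U (U' r) r)
    (hU'' : ∀ r ∈ Ici R0, HasDerivAt U' (U'' r) r)
    (hpos : ∀ r ∈ Ici R0, 0 < U r)
    (hode : ∀ r ∈ Ici R0, U'' r + (m - 1) * U' r / r = -(U r ^ p) / a)
    (hc1 : 0 < c1)
    (hlim1 : Tendsto (fun r => r ^ (m - 2) * U r) atTop (nhds c1))
    (hlim2 : Tendsto (fun r => r ^ (m - 1) * U' r) atTop (nhds l)) :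
    AntitoneOn (fun r => -(U' r * U r ^ (-(m / (m - 2)))) / r) (Ici R0) := by
  have hE := pohozaev_nonpos hm ha hR0 hp1 hp2 hU' hU'' hpos hode hc1 hlim1 hlim2
  have hm2 : 0 < m - 2 := by linarith
  refine antitoneOn_Ici_of_hasDerivAt_nonpos
    (f' := fun r => U r ^ (-(m / (m - 2))) / U r / r *
      (m * (U r * U' r) / r + U r * U r ^ p / a + m / (m - 2) * U' r ^ 2)) ?_ ?_
  · intro r hr
    have hrpos : 0 < r := hR0.trans_le hr
    have hUr := hpos r hr
    have hd := (((hU'' r hr).mul ((hU' r hr).rpow_const (p := -(m / (m - 2)))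
      (Or.inl hUr.ne'))).neg).div (hasDerivAt_id r) hrpos.ne'
    refine hd.congr_deriv ?_
    have h1 : U r ^ (-(m / (m - 2)) - 1) = U r ^ (-(m / (m - 2))) / U r :=
      Real.rpow_sub_one hUr.ne' _
    have h2 : U'' r = -(U r ^ p) / a - (m - 1) * U' r / r := by linarith [hode r hr]
    simp only [Pi.mul_apply, Pi.neg_apply, id]
    rw [h1, h2]
    generalize m / (m - 2) = q
    field_simp
    ring
  · intro r hr
    have hrpos : 0 < r := hR0.trans_le hr
    have hUr := hpos r hr
    have h := hE r hr
    have h4 : r ^ (m - 1) = r ^ m / r := Real.rpow_sub_one hrpos.ne' m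
    have h3 : U r ^ (p + 1) = U r * U r ^ p := by rw [Real.rpow_add_one hUr.ne' p, mul_comm]
    have h5 : U' r ^ 2 / 2 + U r * U r ^ p / (a * (p + 1))
        + (m - 2) / 2 * (U r * U' r / r) ≤ 0 := by
      refine nonpos_of_mul_nonpos_right (a := r ^ m) ?_ (by positivity)
      rw [h4, h3] at h
      linear_combination h
    have h6 : 0 ≤ (2 * m / ((m - 2) * (p + 1)) - 1) := by
      rw [sub_nonneg, one_le_div (by positivity)]
      nlinarith
    have h7 : 0 ≤ (2 * m / ((m - 2) * (p + 1)) - 1) * (U r * U r ^ p / a) := by positivity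
    have h8 : m * (U r * U' r) / r + U r * U r ^ p / a + m / (m - 2) * U' r ^ 2
        = 2 * m / (m - 2) * (U' r ^ 2 / 2 + U r * U r ^ p / (a * (p + 1))
          + (m - 2) / 2 * (U r * U' r / r))
          - (2 * m / ((m - 2) * (p + 1)) - 1) * (U r * U r ^ p / a) := by
      have h9 : p + 1 ≠ 0 := by linarith
      field_simp
      ring
    have h10 : 2 * m / (m - 2) * (U' r ^ 2 / 2 + U r * U r ^ p / (a * (p + 1))
          + (m - 2) / 2 * (U r * U' r / r)) ≤ 0 :=
      mul_nonpos_of_nonneg_of_nonpos (by positivity) h5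
    exact mul_nonpos_of_nonneg_of_nonpos (by positivity) (by rw [h8]; linarith)

/-- The slope `-U' U ^ (-m/(m-2)) / r` of a fast-decaying function has an explicit limit. -/
lemma tendsto_slope {m R0 c1 : ℝ} {U U' : ℝ → ℝ}
    (hm : 2 < m) (hR0 : 0 < R0) (hpos : ∀ r ∈ Ici R0, 0 < U r) (hc1 : 0 < c1)
    (hlim1 : Tendsto (fun r => r ^ (m - 2) * U r) atTop (nhds c1))
    (hlim2 : Tendsto (fun r => r ^ (m - 1) * U' r) atTop (nhds (-(m - 2) * c1))) :
    Tendsto (fun r => -(U' r * U r ^ (-(m / (m - 2)))) / r) atTop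
      (nhds ((m - 2) * c1 ^ (-(2 / (m - 2))))) := by
  have hm2 : m - 2 ≠ 0 := by linarith
  have h := (hlim2.mul (hlim1.rpow_const (p := -(m / (m - 2))) (Or.inl hc1.ne'))).neg
  have hval : -(-(m - 2) * c1 * c1 ^ (-(m / (m - 2)))) = (m - 2) * c1 ^ (-(2 / (m - 2))) := by
    have h1 : -(2 / (m - 2)) = -(m / (m - 2)) + 1 := by field_simp; ring
    rw [h1, Real.rpow_add_one hc1.ne']
    ring
  rw [hval] at h
  refine h.congr' ?_
  filter_upwards [eventually_ge_atTop R0] with r hr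
  have hrpos : 0 < r := hR0.trans_le hr
  have hUr := hpos r hr
  have h1 : (m - 2) * -(m / (m - 2)) = -m := by field_simp
  have h2 : r ^ (m - 1) * r ^ (-m) = 1 / r := by
    rw [← Real.rpow_add hrpos, show m - 1 + -m = -1 by ring, Real.rpow_neg_one, one_div]
  rw [Real.mul_rpow (by positivity) hUr.le, ← Real.rpow_mul hrpos.le, h1]
  linear_combination -(U' r * U r ^ (-(m / (m - 2)))) * h2

/-- Global bounds for the fast-decaying solution of the critical radial Pucci ODE
on its convexity region `[R₀, ∞)`. -/
theorem stmt_0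
    (Ntil a R0 p c1 : ℝ) (U U' U'' : ℝ → ℝ)
    (hN : 2 < Ntil) (ha : 0 < a) (hR0 : 0 < R0)
    (hp1 : 1 < p) (hp2 : p < (Ntil + 2) / (Ntil - 2))
    (hU' : ∀ r ∈ Ici R0, HasDerivAt U (U' r) r)
    (hU'' : ∀ r ∈ Ici R0, HasDerivAt U' (U'' r) r)
    (hU''cont : ContinuousOn U'' (Ici R0))
    (hpos : ∀ r ∈ Ici R0, 0 < U r)
    (hdec : ∀ r ∈ Ici R0, U' r < 0)
    (hinfl : U'' R0 = 0)
    (hode : ∀ r ∈ Ici R0, U'' r + (Ntil - 1) * U' r / r = -(U r ^ p) / a)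
    (hc1 : 0 < c1)
    (hlim1 : Tendsto (fun r => r ^ (Ntil - 2) * U r) atTop (nhds c1))
    (hlim2 : Tendsto (fun r => r ^ (Ntil - 1) * U' r) atTop (nhds (-(Ntil - 2) * c1)))
    (C c : ℝ)
    (hC : C = U R0 ^ (p - 1) / (a * (Ntil - 1) * (Ntil - 2)))
    (hc : c = c1 * (c1 ^ (-Ntil) * U R0 ^ 2) ^ (1 / (Ntil - 2))) :
    ∀ r ∈ Ici R0,
      U R0 / (1 + C * (r ^ 2 - R0 ^ 2)) ^ ((Ntil - 2) / 2) ≤ U r ∧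
      U r ≤ U R0 / (1 + c * (r ^ 2 - R0 ^ 2)) ^ ((Ntil - 2) / 2) := by
  have hm2 : 0 < Ntil - 2 := by linarith
  have hm1 : 0 < Ntil - 1 := by linarith
  have hp2' : p * (Ntil - 2) ≤ Ntil + 2 := ((lt_div_iff₀ hm2).1 hp2).le
  have hanti := antitoneOn_slope hN ha hR0 hp1 hp2' hU' hU'' hpos hode hc1 hlim1 hlim2
  have hlim := tendsto_slope hN hR0 hpos hc1 hlim1 hlim2
  have hU0 := hpos R0 self_mem_Ici
  have hv0 : 0 < U R0 ^ (-(2 / (Ntil - 2))) := by positivity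
  have hexp : -(Ntil / (Ntil - 2)) = -(2 / (Ntil - 2)) - 1 := by field_simp; ring
  have hupper : ∀ r ∈ Ici R0, -(U' r * U r ^ (-(Ntil / (Ntil - 2)))) / r
      ≤ (Ntil - 2) * (U R0 ^ (-(2 / (Ntil - 2))) * C) := by
    intro r hr
    refine (hanti self_mem_Ici hr hr).trans_eq ?_
    have h1 : U' R0 = -(U R0 ^ p) * R0 / (a * (Ntil - 1)) := by
      have h := hode R0 self_mem_Ici
      rw [hinfl] at h
      field_simp at h ⊢
      linarith
    simp only
    rw [h1, hC, hexp, Real.rpow_sub_one hU0.ne', Real.rpow_sub_one hU0.ne']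
    field_simp
  have hcv : U R0 ^ (-(2 / (Ntil - 2))) * c = c1 ^ (-(2 / (Ntil - 2))) := by
    have h1 : (U R0 ^ 2) ^ (1 / (Ntil - 2)) = U R0 ^ (2 / (Ntil - 2)) := by
      rw [← Real.rpow_natCast, ← Real.rpow_mul hU0.le]
      congr 1
      push_cast
      ring
    have h2 : (c1 ^ (-Ntil)) ^ (1 / (Ntil - 2)) = c1 ^ (-(2 / (Ntil - 2))) / c1 := by
      rw [← Real.rpow_mul hc1.le, ← Real.rpow_sub_one hc1.ne', ← hexp]
      congr 1
      ring
    rw [hc, Real.mul_rpow (by positivity) (by positivity), h1, h2, Real.rpow_neg hU0.le]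
    field_simp
  have hlower : ∀ r ∈ Ici R0, (Ntil - 2) * (U R0 ^ (-(2 / (Ntil - 2))) * c)
      ≤ -(U' r * U r ^ (-(Ntil / (Ntil - 2)))) / r := by
    intro r hr
    rw [hcv]
    refine le_of_tendsto hlim ?_
    filter_upwards [eventually_ge_atTop r] with s hs
    exact hanti hr (le_trans (mem_Ici.1 hr) hs) hs
  have hderiv : ∀ k, ∀ r ∈ Ici R0, HasDerivAt (fun r => U r ^ (-(2 / (Ntil - 2))) - k * r ^ 2)
      (2 * r / (Ntil - 2) * (-(U' r * U r ^ (-(Ntil / (Ntil - 2)))) / r - (Ntil - 2) * k)) r := by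
    intro k r hr
    have hrpos : 0 < r := hR0.trans_le hr
    have hd := ((hU' r hr).rpow_const (p := -(2 / (Ntil - 2))) (Or.inl (hpos r hr).ne')).sub
      ((hasDerivAt_pow 2 r).const_mul k)
    refine hd.congr_deriv ?_
    rw [← hexp]
    generalize U r ^ (-(Ntil / (Ntil - 2))) = y
    field_simp
    push_cast
    ring
  have hinv : ∀ x : ℝ, 0 < x → (x ^ (-(2 / (Ntil - 2)))) ^ (-((Ntil - 2) / 2)) = x := by
    intro x hx
    rw [← Real.rpow_mul hx.le]
    have h1 : -(2 / (Ntil - 2)) * -((Ntil - 2) / 2) = 1 := by field_simp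
    rw [h1, Real.rpow_one]
  have hform : ∀ t : ℝ, 0 < t → U R0 / t ^ ((Ntil - 2) / 2)
      = (U R0 ^ (-(2 / (Ntil - 2))) * t) ^ (-((Ntil - 2) / 2)) := by
    intro t ht
    rw [Real.mul_rpow hv0.le ht.le, hinv _ hU0, Real.rpow_neg ht.le, div_eq_mul_inv]
  have hCpos : 0 ≤ C := by rw [hC]; positivity
  have hcpos : 0 ≤ c := by rw [hc]; positivity
  have hexpneg : -((Ntil - 2) / 2) ≤ 0 := by linarith
  intro r hr
  have hrpos : 0 < r := hR0.trans_le hr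
  have hUr := hpos r hr
  have hsq : 0 ≤ r ^ 2 - R0 ^ 2 := sub_nonneg.2 (pow_le_pow_left₀ hR0.le hr 2)
  have hv : 0 < U r ^ (-(2 / (Ntil - 2))) := by positivity
  constructor
  · have h := antitoneOn_Ici_of_hasDerivAt_nonpos (hderiv (U R0 ^ (-(2 / (Ntil - 2))) * C))
      (fun s hs => mul_nonpos_of_nonneg_of_nonpos
        (by have : 0 < s := hR0.trans_le hs
            positivity) (by linarith [hupper s hs])) self_mem_Ici hr hr
    rw [hform _ (by positivity)]
    conv_rhs => rw [← hinv _ hUr]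
    exact Real.rpow_le_rpow_of_nonpos hv (by simp only at h; linarith) hexpneg
  · have h := monotoneOn_Ici_of_hasDerivAt_nonneg (hderiv (U R0 ^ (-(2 / (Ntil - 2))) * c))
      (fun s hs => mul_nonneg
        (by have : 0 < s := hR0.trans_le hs
            positivity) (by linarith [hlower s hs])) self_mem_Ici hr hr
    rw [hform _ (by positivity)]
    conv_lhs => rw [← hinv _ hUr]
    exact Real.rpow_le_rpow_of_nonpos (by positivity) (by simp only at h; linarith) hexpneg
end

section
/- Let Ñ > 2 and a > 0 be real numbers, R₀ > 0, and Ñ/(Ñ−2) < p < (Ñ+2)/(Ñ−2). Let U be a C² function on [R₀,∞) with U > 0 and U' < 0 on [R₀,∞), satisfying U''(r) + (Ñ−1)·U'(r)/r = −U(r)^p/a for all r ≥ R₀, and suppose that for some constant c₁ > 0 one has r^{Ñ−2}·U(r) → c₁ and r^{Ñ−1}·U'(r) → −(Ñ−2)·c₁ as r → ∞. Then the integral ∫_{R₀}^∞ r^{Ñ−1}·U(r)^{p+1} dr converges and the following identity holds: (Ñ + 2 − p·(Ñ−2))·∫_{R₀}^∞ r^{Ñ−1}·U(r)^{p+1} dr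 = −a·(p+1)·[ R₀^Ñ·( U'(R₀)² + (2/(a·(p+1)))·U(R₀)^{p+1} ) + (Ñ−2)·R₀^{Ñ−1}·U'(R₀)·U(R₀) ]. -/
open Real Filter Set MeasureTheory

/-- The Pohozaev functional `H_{2/a, N - 2}` of a function `U` with derivative `U'`. -/
noncomputable def pohozaev (N a p : ℝ) (U U' : ℝ → ℝ) (r : ℝ) : ℝ :=
  r ^ N * (U' r ^ 2 + 2 / (a * (p + 1)) * U r ^ (p + 1)) + (N - 2) * r ^ (N - 1) * U' r * U r

lemma hasDerivAt_pohozaev {N a p r u'' : ℝ} {U U' : ℝ → ℝ} (ha : 0 < a) (hp : 0 < p + 1)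
    (hr : 0 < r) (hU : HasDerivAt U (U' r) r) (hU' : HasDerivAt U' u'' r) (hpos : 0 < U r)
    (hode : u'' + (N - 1) * U' r / r = -(U r ^ p) / a) :
    HasDerivAt (pohozaev N a p U U')
      ((N + 2 - p * (N - 2)) / (a * (p + 1)) * (r ^ (N - 1) * U r ^ (p + 1))) r := by
  have hN : HasDerivAt (fun r : ℝ => r ^ N) (N * r ^ (N - 1)) r :=
    Real.hasDerivAt_rpow_const (Or.inl hr.ne')
  have hN1 : HasDerivAt (fun r : ℝ => r ^ (N - 1)) ((N - 1) * r ^ (N - 1 - 1)) r :=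
    Real.hasDerivAt_rpow_const (Or.inl hr.ne')
  have hUp : HasDerivAt (fun r => U r ^ (p + 1)) (U' r * (p + 1) * U r ^ (p + 1 - 1)) r :=
    hU.rpow_const (Or.inl hpos.ne')
  have key := (hN.mul ((hU'.pow 2).add (hUp.const_mul (2 / (a * (p + 1)))))).add
    (((hN1.const_mul (N - 2)).mul hU').mul hU)
  refine key.congr_deriv ?_
  have e : u'' = -(U r ^ p) / a - (N - 1) * U' r / r := by linarith
  have r1 : r ^ (N - 1) = r ^ (N - 1 - 1) * r := by
    rw [← Real.rpow_add_one hr.ne']; ring_nf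
  have r0 : r ^ N = r ^ (N - 1 - 1) * r * r := by
    rw [← r1, ← Real.rpow_add_one hr.ne']; ring_nf
  have u1 : U r ^ (p + 1) = U r ^ p * U r := Real.rpow_add_one hpos.ne' p
  have u0 : p + 1 - 1 = p := by ring
  simp only [Pi.add_apply, Pi.mul_apply, Pi.pow_apply]
  rw [r0, u0, u1, r1, e]
  field_simp
  ring

lemma tendsto_pohozaev {N a p c d : ℝ} {U U' : ℝ → ℝ} (hN : 2 < N) (hp : 0 < p + 1)
    (hp1 : N / (N - 2) < p) (hpos : ∀ᶠ r in atTop, 0 < U r)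
    (hlim1 : Tendsto (fun r => r ^ (N - 2) * U r) atTop (nhds c))
    (hlim2 : Tendsto (fun r => r ^ (N - 1) * U' r) atTop (nhds d)) :
    Tendsto (pohozaev N a p U U') atTop (nhds 0) := by
  have hexp : 0 < (N - 2) * p - 2 := by
    rw [div_lt_iff₀ (by linarith)] at hp1
    linarith
  have t1 : Tendsto (fun r : ℝ => r ^ (-(N - 2))) atTop (nhds 0) :=
    tendsto_rpow_neg_atTop (by linarith)
  have t2 : Tendsto (fun r : ℝ => r ^ (-((N - 2) * p - 2))) atTop (nhds 0) :=
    tendsto_rpow_neg_atTop hexp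
  have t3 := hlim1.rpow_const (p := p + 1) (Or.inr hp.le)
  have key := ((t1.mul (hlim2.pow 2)).add
    ((t2.mul t3).const_mul (2 / (a * (p + 1))))).add
    ((t1.mul (hlim2.mul hlim1)).const_mul (N - 2))
  simp only [zero_mul, mul_zero, add_zero] at key
  refine key.congr' ?_
  filter_upwards [hpos, eventually_gt_atTop 0] with r hu hr
  have e1 : r ^ (-(N - 2)) * (r ^ (N - 1)) ^ 2 = r ^ N := by
    rw [sq, ← Real.rpow_add hr, ← Real.rpow_add hr]; ring_nf
  have e2 : r ^ (-((N - 2) * p - 2)) * (r ^ (N - 2) * U r) ^ (p + 1) = r ^ N * U r ^ (p + 1) := by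
    rw [Real.mul_rpow (by positivity) hu.le, ← Real.rpow_mul hr.le, ← mul_assoc,
      ← Real.rpow_add hr]
    ring_nf
  have e3 : r ^ (-(N - 2)) * r ^ (N - 2) = 1 := by
    rw [← Real.rpow_add hr]; simp
  unfold pohozaev
  rw [e2, mul_pow, ← mul_assoc (r ^ (-(N - 2))), e1]
  linear_combination (N - 2) * r ^ (N - 1) * U' r * U r * e3

/-- Integral characterization of the critical exponent: integrating the derivative of
the Pohozaev functional `H_{2/a, Ñ−2}` over `[R₀, ∞)` for a fast-decaying solution. -/
theorem stmt_2
    (Ntil a R0 p c1 : ℝ) (U U' U'' : ℝ → ℝ)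
    (hN : 2 < Ntil) (ha : 0 < a) (hR0 : 0 < R0)
    (hp1 : Ntil / (Ntil - 2) < p) (hp2 : p < (Ntil + 2) / (Ntil - 2))
    (hU' : ∀ r ∈ Ici R0, HasDerivAt U (U' r) r)
    (hU'' : ∀ r ∈ Ici R0, HasDerivAt U' (U'' r) r)
    (hU''cont : ContinuousOn U'' (Ici R0))
    (hpos : ∀ r ∈ Ici R0, 0 < U r)
    (hdec : ∀ r ∈ Ici R0, U' r < 0)
    (hode : ∀ r ∈ Ici R0, U'' r + (Ntil - 1) * U' r / r = -(U r ^ p) / a)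
    (hc1 : 0 < c1)
    (hlim1 : Tendsto (fun r => r ^ (Ntil - 2) * U r) atTop (nhds c1))
    (hlim2 : Tendsto (fun r => r ^ (Ntil - 1) * U' r) atTop (nhds (-(Ntil - 2) * c1))) :
    IntegrableOn (fun r => r ^ (Ntil - 1) * U r ^ (p + 1)) (Ioi R0) ∧
    (Ntil + 2 - p * (Ntil - 2)) * ∫ r in Ioi R0, r ^ (Ntil - 1) * U r ^ (p + 1) =
      -(a * (p + 1)) *
        (R0 ^ Ntil * (U' R0 ^ 2 + 2 / (a * (p + 1)) * U R0 ^ (p + 1))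
          + (Ntil - 2) * R0 ^ (Ntil - 1) * U' R0 * U R0) := by
  have hN2 : 0 < Ntil - 2 := by linarith
  have hp : 0 < p + 1 := by
    have : 0 < Ntil / (Ntil - 2) := by positivity
    linarith
  have hcoef : 0 < Ntil + 2 - p * (Ntil - 2) := by
    rw [lt_div_iff₀ hN2] at hp2
    linarith
  have hK : 0 < (Ntil + 2 - p * (Ntil - 2)) / (a * (p + 1)) := by positivity
  have hderiv : ∀ r ∈ Ici R0, HasDerivAt (pohozaev Ntil a p U U') _ r := fun r hr =>
    hasDerivAt_pohozaev ha hp (hR0.trans_le hr) (hU' r hr) (hU'' r hr) (hpos r hr) (hode r hr)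
  have hlim : Tendsto (pohozaev Ntil a p U U') atTop (nhds 0) :=
    tendsto_pohozaev hN hp hp1 ((eventually_ge_atTop R0).mono hpos) hlim1 hlim2
  have hnonneg : ∀ r ∈ Ioi R0, 0 ≤ (Ntil + 2 - p * (Ntil - 2)) / (a * (p + 1)) *
      (r ^ (Ntil - 1) * U r ^ (p + 1)) := fun r hr => by
    have h1 := hR0.trans hr
    have h2 := hpos r (Ioi_subset_Ici_self hr)
    positivity
  refine ⟨(integrable_const_mul_iff hK.ne'.isUnit _).1
    (integrableOn_Ioi_deriv_of_nonneg' hderiv hnonneg hlim), ?_⟩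
  have key := integral_Ioi_of_hasDerivAt_of_nonneg' hderiv hnonneg hlim
  rw [integral_const_mul, zero_sub, div_mul_eq_mul_div, div_eq_iff (by positivity)] at key
  rw [key, pohozaev]
  ring
end
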